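/- Set 𝐓1 = σ2∘σ1∘w2∘w3∘w0, 𝐓2 = (σ1∘σ2)²∘w0∘w3∘w1∘w0, 𝐓3 = σ1∘σ2∘w2∘w1∘w0 ∈ Ŵ. Then for each i ∈ {1,2,3}: 𝐓_i(α0) = α0 − δ, 𝐓_i(α_i) = α_i + δ, and 𝐓_i(α_j) = α_j for j ∈ {1,2,3}, j ≠ i; equivalently, 𝐓_i acts on the ℚ-span of α0, α1, α2, α3 as the translation v ↦ v − (h_i•v)δ associated to the fundamental weight h_i. -/

import Mathlib

open Pointwise

/-- The Picard lattice `Pic`, with basis `H1, H2, E1, …, E8`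
(coordinates `0 ↦ H1`, `1 ↦ H2`, `i+1 ↦ Eᵢ`). -/
abbrev Pic : Type := Fin 10 → ℤ

/-- The intersection form `•` : `H1•H2 = 1`, `Eᵢ•Eᵢ = -1`, all other pairings
of basis vectors being `0`. -/
def inter (x y : Pic) : ℤ :=
  x 0 * y 1 + x 1 * y 0 -
    (x 2 * y 2 + x 3 * y 3 + x 4 * y 4 + x 5 * y 5 + x 6 * y 6 +
      x 7 * y 7 + x 8 * y 8 + x 9 * y 9)

/-- The `j`-th basis vector of `Pic`. -/
def bvec (j : Fin 10) : Pic := fun k => if k = j then 1 else 0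

/-- The matrix of the reflection `C ↦ C + (C • a)·a` in `a`. -/
def reflMat (a : Pic) : Matrix (Fin 10) (Fin 10) ℤ :=
  Matrix.of fun k j => (if k = j then 1 else 0) + inter (bvec j) a * a k

/-- The matrix of the linear map sending the basis vector `e j` to `e (p j)`. -/
def permMat (p : Fin 10 → Fin 10) : Matrix (Fin 10) (Fin 10) ℤ :=
  Matrix.of fun k j => if p j = k then 1 else 0

/-- `α₀ = H2 - E1 - E2`. -/
def al0 : Pic := ![0, 1, -1, -1, 0, 0, 0, 0, 0, 0]
/-- `α₁ = H1 - E5 - E6`. -/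
def al1 : Pic := ![1, 0, 0, 0, 0, 0, -1, -1, 0, 0]
/-- `α₂ = H2 - E3 - E4`. -/
def al2 : Pic := ![0, 1, 0, 0, -1, -1, 0, 0, 0, 0]
/-- `α₃ = H1 - E7 - E8`. -/
def al3 : Pic := ![1, 0, 0, 0, 0, 0, 0, 0, -1, -1]
/-- `δ = 2H1 + 2H2 - E1 - ⋯ - E8`. -/
def dl : Pic := ![2, 2, -1, -1, -1, -1, -1, -1, -1, -1]
/-- `μ = H1 - H2`. -/
def mu : Pic := ![1, -1, 0, 0, 0, 0, 0, 0, 0, 0]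

/-- Automorphisms of the lattice `Pic`, realized as invertible integer `10 × 10`
matrices (acting on coordinate vectors by matrix-vector multiplication). -/
abbrev PicAut : Type := (Matrix (Fin 10) (Fin 10) ℤ)ˣ

/-- Build an automorphism of `Pic` out of an involutive matrix. -/
def mkAut (M : Matrix (Fin 10) (Fin 10) ℤ) (h : M * M = 1) : PicAut := ⟨M, M, h, h⟩

/-- `w₀`, the reflection `C ↦ C + (C•α₀)α₀`. -/
def w0 : PicAut := mkAut (reflMat al0) (by decide)
/-- `w₁`, the reflection `C ↦ C + (C•α₁)α₁`. -/
def w1 : PicAut := mkAut (reflMat al1) (by decide)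
/-- `w₂`, the reflection `C ↦ C + (C•α₂)α₂`. -/
def w2 : PicAut := mkAut (reflMat al2) (by decide)
/-- `w₃`, the reflection `C ↦ C + (C•α₃)α₃`. -/
def w3 : PicAut := mkAut (reflMat al3) (by decide)
/-- `σ₁`: the basis permutation `E1↔E7, E2↔E8, E3↔E5, E4↔E6` (fixing `H1`, `H2`)
composed with the reflection `w_μ` in `μ = H1 - H2`. -/
def sg1 : PicAut := mkAut (permMat ![0, 1, 8, 9, 6, 7, 4, 5, 2, 3] * reflMat mu) (by decide)
/-- `σ₂`: the basis permutation `E1↔E3, E2↔E4` (fixing the other basis vectors). -/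
def sg2 : PicAut := mkAut (permMat ![0, 1, 4, 5, 2, 3, 6, 7, 8, 9]) (by decide)
/-- `σ₃`: the basis permutation `E5↔E7, E6↔E8` (fixing the other basis vectors). -/
def sg3 : PicAut := mkAut (permMat ![0, 1, 2, 3, 4, 5, 8, 9, 6, 7]) (by decide)

/-- The action of an automorphism on `Pic`. -/
def act (g : PicAut) (v : Pic) : Pic := g.val.mulVec v

instance : MulAction PicAut Pic where
  smul := act
  one_smul v := by
    show act 1 v = v
    simp [act]
  mul_smul g h v := by
    show act (g * h) v = act g (act h v)
    simp [act, Matrix.mulVec_mulVec]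

lemma smul_eq_act (g : PicAut) (v : Pic) : g • v = act g v := rfl

/-- The fully extended affine Weyl group `Ŵ` of type `A₃⁽¹⁾`, i.e. the subgroup
of automorphisms of `Pic` generated by `w₀, w₁, w₂, w₃, σ₁, σ₂`. -/
def Wh : Subgroup PicAut := Subgroup.closure {w0, w1, w2, w3, sg1, sg2}

/-- `Pic ⊗ ℚ`. -/
abbrev PicQ : Type := Fin 10 → ℚ

/-- The intersection form on `Pic ⊗ ℚ`. -/
def interQ (x y : PicQ) : ℚ :=
  x 0 * y 1 + x 1 * y 0 -
    (x 2 * y 2 + x 3 * y 3 + x 4 * y 4 + x 5 * y 5 + x 6 * y 6 +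
      x 7 * y 7 + x 8 * y 8 + x 9 * y 9)

/-- The natural map `Pic → Pic ⊗ ℚ`. -/
def toQ (v : Pic) : PicQ := fun i => (v i : ℚ)

/-- The action of an automorphism of `Pic` on `Pic ⊗ ℚ`. -/
def actQ (g : PicAut) (v : PicQ) : PicQ := (g.val.map (Int.cast : ℤ → ℚ)).mulVec v

/-- The fundamental weight `h₁ = (3α₁ + 2α₂ + α₃)/4` of the finite `A₃` subsystem. -/
def h1Q : PicQ := (3/4 : ℚ) • toQ al1 + (1/2 : ℚ) • toQ al2 + (1/4 : ℚ) • toQ al3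
/-- The fundamental weight `h₂ = (α₁ + 2α₂ + α₃)/2` of the finite `A₃` subsystem. -/
def h2Q : PicQ := (1/2 : ℚ) • toQ al1 + (1 : ℚ) • toQ al2 + (1/2 : ℚ) • toQ al3
/-- The fundamental weight `h₃ = (α₁ + 2α₂ + 3α₃)/4` of the finite `A₃` subsystem. -/
def h3Q : PicQ := (1/4 : ℚ) • toQ al1 + (1/2 : ℚ) • toQ al2 + (3/4 : ℚ) • toQ al3

/-- The ℚ-span of the symmetry roots `α₀, α₁, α₂, α₃`. -/
def symmSpan : Submodule ℚ PicQ :=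
  Submodule.span ℚ ({toQ al0, toQ al1, toQ al2, toQ al3} : Set PicQ)

/-- `𝐓₁ = σ₂σ₁w₂w₃w₀`. -/
def T1 : PicAut := sg2 * sg1 * w2 * w3 * w0
/-- `𝐓₂ = (σ₁σ₂)²w₀w₃w₁w₀`. -/
def T2 : PicAut := (sg1 * sg2) ^ 2 * w0 * w3 * w1 * w0
/-- `𝐓₃ = σ₁σ₂w₂w₁w₀`. -/
def T3 : PicAut := sg1 * sg2 * w2 * w1 * w0

lemma act_mul (g h : PicAut) (v : Pic) : act (g * h) v = act g (act h v) :=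
  mul_smul g h v

lemma act_add (g : PicAut) (u v : Pic) : act g (u + v) = act g u + act g v :=
  Matrix.mulVec_add _ _ _

lemma act_neg (g : PicAut) (v : Pic) : act g (-v) = -act g v :=
  Matrix.mulVec_neg _ _

lemma dl_eq_sum : dl = al0 + al1 + al2 + al3 := by decide

lemma act_w0 : act w0 al0 = -al0 ∧ act w0 al1 = al0 + al1 ∧ act w0 al2 = al2 ∧
    act w0 al3 = al0 + al3 := by
  refine ⟨?_, ?_, ?_, ?_⟩ <;> decide

lemma act_w1 : act w1 al0 = al0 + al1 ∧ act w1 al1 = -al1 ∧ act w1 al2 = al1 + al2 ∧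
    act w1 al3 = al3 := by
  refine ⟨?_, ?_, ?_, ?_⟩ <;> decide

lemma act_w2 : act w2 al0 = al0 ∧ act w2 al1 = al1 + al2 ∧ act w2 al2 = -al2 ∧
    act w2 al3 = al2 + al3 := by
  refine ⟨?_, ?_, ?_, ?_⟩ <;> decide

lemma act_w3 : act w3 al0 = al0 + al3 ∧ act w3 al1 = al1 ∧ act w3 al2 = al2 + al3 ∧
    act w3 al3 = -al3 := by
  refine ⟨?_, ?_, ?_, ?_⟩ <;> decide

lemma act_sg1 : act sg1 al0 = al3 ∧ act sg1 al1 = al2 ∧ act sg1 al2 = al1 ∧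
    act sg1 al3 = al0 := by
  refine ⟨?_, ?_, ?_, ?_⟩ <;> decide

lemma act_sg2 : act sg2 al0 = al2 ∧ act sg2 al1 = al1 ∧ act sg2 al2 = al0 ∧
    act sg2 al3 = al3 := by
  refine ⟨?_, ?_, ?_, ?_⟩ <;> decide

lemma act_T1 : act T1 al0 = al0 - dl ∧ act T1 al1 = al1 + dl ∧ act T1 al2 = al2 ∧
    act T1 al3 = al3 := by
  simp only [T1, act_mul, act_add, act_neg, act_w0, act_w2, act_w3, act_sg1, act_sg2, dl_eq_sum]
  refine ⟨?_, ?_, ?_, ?_⟩ <;> abel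

lemma act_T2 : act T2 al0 = al0 - dl ∧ act T2 al2 = al2 + dl ∧ act T2 al1 = al1 ∧
    act T2 al3 = al3 := by
  simp only [T2, pow_two, act_mul, act_add, act_neg, act_w0, act_w1, act_w3, act_sg1, act_sg2,
    dl_eq_sum]
  refine ⟨?_, ?_, ?_, ?_⟩ <;> abel

lemma act_T3 : act T3 al0 = al0 - dl ∧ act T3 al3 = al3 + dl ∧ act T3 al1 = al1 ∧
    act T3 al2 = al2 := by
  simp only [T3, act_mul, act_add, act_neg, act_w0, act_w1, act_w2, act_sg1, act_sg2, dl_eq_sum]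
  refine ⟨?_, ?_, ?_, ?_⟩ <;> abel

lemma actQ_toQ (g : PicAut) (v : Pic) : actQ g (toQ v) = toQ (act g v) :=
  funext fun i => (RingHom.map_mulVec (Int.castRingHom ℚ) g.val v i).symm

lemma toQ_add (u v : Pic) : toQ (u + v) = toQ u + toQ v := by
  ext; simp [toQ]

lemma toQ_sub (u v : Pic) : toQ (u - v) = toQ u - toQ v := by
  ext; simp [toQ]

lemma interQ_add_right (h u v : PicQ) : interQ h (u + v) = interQ h u + interQ h v := by
  simp only [interQ, Pi.add_apply]; ring

lemma interQ_smul_right (c : ℚ) (h v : PicQ) : interQ h (c • v) = c * interQ h v := by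
  simp only [interQ, Pi.smul_apply, smul_eq_mul]; ring

/-- The property of acting as the translation `v ↦ v - (h•v)δ` extends from the symmetry roots
to their span. -/
lemma actQ_eq_translation_of_roots {g : PicAut} {h : PicQ}
    (h0 : actQ g (toQ al0) = toQ al0 - interQ h (toQ al0) • toQ dl)
    (h1 : actQ g (toQ al1) = toQ al1 - interQ h (toQ al1) • toQ dl)
    (h2 : actQ g (toQ al2) = toQ al2 - interQ h (toQ al2) • toQ dl)
    (h3 : actQ g (toQ al3) = toQ al3 - interQ h (toQ al3) • toQ dl) :
    ∀ v ∈ symmSpan, actQ g v = v - interQ h v • toQ dl := by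
  intro v hv
  induction hv using Submodule.span_induction with
  | mem x hx =>
    rcases hx with rfl | rfl | rfl | rfl
    exacts [h0, h1, h2, h3]
  | zero => simp [actQ, interQ]
  | add x y _ _ hx hy =>
    have hadd : actQ g (x + y) = actQ g x + actQ g y := Matrix.mulVec_add _ _ _
    rw [hadd, hx, hy, interQ_add_right]
    module
  | smul c x _ hx =>
    have hsmul : actQ g (c • x) = c • actQ g x := Matrix.mulVec_smul _ _ _
    rw [hsmul, hx, interQ_smul_right]
    module

lemma interQ_h1Q : interQ h1Q (toQ al0) = 1 ∧ interQ h1Q (toQ al1) = -1 ∧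
    interQ h1Q (toQ al2) = 0 ∧ interQ h1Q (toQ al3) = 0 := by
  simp [interQ, h1Q, toQ, al0, al1, al2, al3]
  norm_num

lemma interQ_h2Q : interQ h2Q (toQ al0) = 1 ∧ interQ h2Q (toQ al1) = 0 ∧
    interQ h2Q (toQ al2) = -1 ∧ interQ h2Q (toQ al3) = 0 := by
  simp [interQ, h2Q, toQ, al0, al1, al2, al3]
  norm_num

lemma interQ_h3Q : interQ h3Q (toQ al0) = 1 ∧ interQ h3Q (toQ al1) = 0 ∧
    interQ h3Q (toQ al2) = 0 ∧ interQ h3Q (toQ al3) = -1 := by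
  simp [interQ, h3Q, toQ, al0, al1, al2, al3]
  norm_num

/-- Each `𝐓ᵢ` maps `α₀ ↦ α₀ - δ`, `αᵢ ↦ αᵢ + δ` and fixes the other finite simple
roots; equivalently, `𝐓ᵢ` acts on the ℚ-span of `α₀, …, α₃` as the translation
`v ↦ v - (hᵢ•v)δ` associated to the fundamental weight `hᵢ`. -/
theorem stmt6 :
    (act T1 al0 = al0 - dl ∧ act T1 al1 = al1 + dl ∧ act T1 al2 = al2 ∧ act T1 al3 = al3 ∧
      ∀ v ∈ symmSpan, actQ T1 v = v - interQ h1Q v • toQ dl) ∧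
    (act T2 al0 = al0 - dl ∧ act T2 al2 = al2 + dl ∧ act T2 al1 = al1 ∧ act T2 al3 = al3 ∧
      ∀ v ∈ symmSpan, actQ T2 v = v - interQ h2Q v • toQ dl) ∧
    (act T3 al0 = al0 - dl ∧ act T3 al3 = al3 + dl ∧ act T3 al1 = al1 ∧ act T3 al2 = al2 ∧
      ∀ v ∈ symmSpan, actQ T3 v = v - interQ h3Q v • toQ dl) := by
  obtain ⟨a0, a1, a2, a3⟩ := act_T1
  obtain ⟨b0, b2, b1, b3⟩ := act_T2
  obtain ⟨c0, c3, c1, c2⟩ := act_T3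
  refine ⟨⟨a0, a1, a2, a3, actQ_eq_translation_of_roots ?_ ?_ ?_ ?_⟩,
    ⟨b0, b2, b1, b3, actQ_eq_translation_of_roots ?_ ?_ ?_ ?_⟩,
    ⟨c0, c3, c1, c2, actQ_eq_translation_of_roots ?_ ?_ ?_ ?_⟩⟩ <;>
  simp [actQ_toQ, toQ_add, toQ_sub, interQ_h1Q, interQ_h2Q, interQ_h3Q, *]
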